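/- Fix n a positive integer and ℓ ∈ ℝⁿ, and for e ∈ F₂ⁿ define s(e) = ∏_{i : e_i = 1} 1/(1+exp(|ℓ_i|)) · ∏_{i : e_i = 0} exp(|ℓ_i|)/(1+exp(|ℓ_i|)). Assume the map e ↦ Σ_{i : e_i = 1} |ℓ_i| is injective on F₂ⁿ. Then a bijection π : {1, …, 2ⁿ} → F₂ⁿ satisfies s(π(1)) > s(π(2)) > … > s(π(2ⁿ)) if and only if Σ_{i : π(1)_i = 1} |ℓ_i| < Σ_{i : π(2)_i = 1} |ℓ_i| < … < Σ_{i : π(2ⁿ)_i = 1} |ℓ_i|. -/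

import Mathlib

open Finset

/-- The posterior probability `s(e)` of an error pattern `e` given LLR magnitudes `|ℓ_i|`. -/
noncomputable def sPost {n : ℕ} (ℓ : Fin n → ℝ) (e : Fin n → ZMod 2) : ℝ :=
  (∏ i ∈ univ.filter (fun i => e i = 1), 1 / (1 + Real.exp |ℓ i|)) *
    (∏ i ∈ univ.filter (fun i => e i = 0), Real.exp |ℓ i| / (1 + Real.exp |ℓ i|))

/-- The accumulated reliability `Σ_{i : e_i = 1} |ℓ_i|` of an error pattern `e`. -/
noncomputable def reliability {n : ℕ} (ℓ : Fin n → ℝ) (e : Fin n → ZMod 2) : ℝ :=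
  ∑ i ∈ univ.filter (fun i => e i = 1), |ℓ i|

lemma sPost_eq_aux {n : ℕ} (ℓ : Fin n → ℝ) (e : Fin n → ZMod 2) :
    sPost ℓ e = Real.exp (-reliability ℓ e) *
      ∏ i, (Real.exp |ℓ i| / (1 + Real.exp |ℓ i|)) := by
  have hz : ∀ z : ZMod 2, z = 0 ↔ ¬ z = 1 := by decide
  have hf : univ.filter (fun i => e i = 0) = univ.filter (fun i => ¬ e i = 1) := by
    ext i
    simp only [mem_filter, mem_univ, true_and]
    exact hz (e i)
  unfold sPost reliability
  rw [hf, ← Finset.prod_filter_mul_prod_filter_not univ (fun i => e i = 1)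
    (fun i => Real.exp |ℓ i| / (1 + Real.exp |ℓ i|)), ← mul_assoc, ← Finset.sum_neg_distrib,
    Real.exp_sum, ← Finset.prod_mul_distrib]
  congr 1
  refine Finset.prod_congr rfl fun i _ => ?_
  rw [← mul_div_assoc, ← Real.exp_add, neg_add_cancel, Real.exp_zero]

lemma sPost_lt_aux {n : ℕ} (ℓ : Fin n → ℝ) (e f : Fin n → ZMod 2) :
    sPost ℓ e < sPost ℓ f ↔ reliability ℓ f < reliability ℓ e := by
  have hp : 0 < ∏ i, (Real.exp |ℓ i| / (1 + Real.exp |ℓ i|)) :=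
    Finset.prod_pos fun i _ => by positivity
  rw [sPost_eq_aux, sPost_eq_aux, mul_lt_mul_iff_left₀ hp, Real.exp_lt_exp, neg_lt_neg_iff]

/-- Proposition 1 of the paper: assuming no ties in accumulated reliabilities, a bijection
`π : {1,…,2ⁿ} → F₂ⁿ` arranges the posteriors `s(π(t))` in strictly decreasing order iff it
arranges the accumulated reliabilities in strictly increasing order (SGRAND's ordering). -/
theorem decreasing_posterior_iff_increasing_reliability {n : ℕ} (hn : 0 < n) (ℓ : Fin n → ℝ)
    (hinj : Function.Injective (reliability ℓ))
    (π : Fin (2 ^ n) ≃ (Fin n → ZMod 2)) :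
    StrictAnti (fun t => sPost ℓ (π t)) ↔ StrictMono (fun t => reliability ℓ (π t)) := by
  constructor
  · intro h a b hab
    exact (sPost_lt_aux ℓ _ _).1 (h hab)
  · intro h a b hab
    exact (sPost_lt_aux ℓ _ _).2 (h hab)
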